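/- arXiv:2305.08064 — 18 statements merged into one kernel-verified Lean document; each statement's English description precedes it below -/
import Mathlib

section
/- If a precat-semigroup S satisfies the weak congruence conditions, then S is a cat-semigroup; that is, for all x, y in S, if R(x) = D(y) then D(xy) = D(x) and R(xy) = R(y). -/
/-- If a precat-semigroup S satisfies the weak congruence conditions,
then S is a cat-semigroup. -/
theorem precat_weak_congruence_implies_cat
    {S : Type*} [Semigroup S] (D R : S → S)
    (hD : ∀ x, D x * x = x) (hR : ∀ x, x * R x = x)
    (hDD : ∀ x, D x * D x = D x) (hDR : ∀ x, D (R x) = R x) (hRD : ∀ x, R (D x) = D x)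
    (hlw : ∀ x y, D (x * y) = D (x * D (R x * y)))
    (hrw : ∀ x y, R (x * y) = R (R (x * D y) * y)) :
    ∀ x y : S, R x = D y → D (x * y) = D x ∧ R (x * y) = R y := by
  intro x y h
  constructor
  · rw [hlw, h, hD, ← h, hR]
  · rw [hrw, ← h, hR, h, hD]
end

section
/- If a cat-semigroup S satisfies the law R(sD(t)) = D(R(s)t) for all s, t, then S satisfies the match-up conditions: R(xD(y)) = D(R(xD(y))y) and D(R(x)y) = R(xD(R(x)y)) for all x, y. -/
/-- If a cat-semigroup S satisfies the law R(sD(t)) = D(R(s)t) for all s, t,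
then S satisfies the match-up conditions. -/
theorem cat_strong_law_implies_matchup
    {S : Type*} [Semigroup S] (D R : S → S)
    (hD : ∀ x, D x * x = x) (hR : ∀ x, x * R x = x)
    (hDD : ∀ x, D x * D x = D x) (hDR : ∀ x, D (R x) = R x) (hRD : ∀ x, R (D x) = D x)
    (hcat : ∀ x y, R x = D y → D (x * y) = D x ∧ R (x * y) = R y)
    (hlaw : ∀ s t, R (s * D t) = D (R s * t)) :
    (∀ x y, R (x * D y) = D (R (x * D y) * y)) ∧
    (∀ x y, D (R x * y) = R (x * D (R x * y))) := by
  refine ⟨fun x y => ?_, fun x y => ?_⟩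
  · rw [← hlaw (x * D y) y, mul_assoc, hDD]
  · have hRR : R x * R x = R x := by simpa only [hDR] using hDD (R x)
    rw [hlaw x (R x * y), ← mul_assoc, hRR]
end

section
/- A precat-semigroup S is a cat-semigroup satisfying the left match-up condition if and only if S satisfies the left congruence condition, the right weak congruence condition, and the law R(st) = D(R(st)R(t)) for all s, t. -/
/-- A precat-semigroup S is a cat-semigroup satisfying the left match-up
condition iff S satisfies the left congruence condition, the right weak congruence
condition, and the law R(st) = D(R(st)R(t)). -/
theorem cat_left_matchup_characterisation
    {S : Type*} [Semigroup S] (D R : S → S)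
    (hD : ∀ x, D x * x = x) (hR : ∀ x, x * R x = x)
    (hDD : ∀ x, D x * D x = D x) (hDR : ∀ x, D (R x) = R x) (hRD : ∀ x, R (D x) = D x) :
    ((∀ x y, R x = D y → D (x * y) = D x ∧ R (x * y) = R y) ∧
      (∀ x y, R (x * D y) = D (R (x * D y) * y))) ↔
    ((∀ x y, D (x * y) = D (x * D y)) ∧
      (∀ x y, R (x * y) = R (R (x * D y) * y)) ∧
      (∀ s t, R (s * t) = D (R (s * t) * R t))) := by
  constructor
  · rintro ⟨hcat, hmatch⟩
    have key (x y : S) :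
        D (x * y) = D (x * D y) ∧ R (x * y) = R (R (x * D y) * y) := by
      have h := hcat (x * D y) (R (x * D y) * y) (hmatch x y)
      rwa [← mul_assoc, hR, mul_assoc, hD] at h
    refine ⟨fun x y => (key x y).1, fun x y => (key x y).2, fun s t => ?_⟩
    have h := hmatch (s * t) (R t)
    rwa [hDR, mul_assoc, hR] at h
  · rintro ⟨hleft, hright, hlaw⟩
    refine ⟨fun x y hxy => ⟨?_, ?_⟩, fun x y => ?_⟩
    · rw [hleft, ← hxy, hR]
    · rw [hright, ← hxy, hR, hxy, hD]
    · have h := hlaw x (D y)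
      rwa [hRD, ← hleft] at h
end

section
/- A precat-semigroup S is a cat-semigroup satisfying the match-up conditions if and only if S satisfies the congruence conditions together with the two laws R(st) = D(R(st)R(t)) and D(st) = R(D(s)D(st)) for all s, t. -/
/-- A precat-semigroup S is a cat-semigroup satisfying the match-up
conditions iff S satisfies the congruence conditions together with the laws
R(st) = D(R(st)R(t)) and D(st) = R(D(s)D(st)). -/
theorem cat_matchup_characterisation
    {S : Type*} [Semigroup S] (D R : S → S)
    (hD : ∀ x, D x * x = x) (hR : ∀ x, x * R x = x)
    (hDD : ∀ x, D x * D x = D x) (hDR : ∀ x, D (R x) = R x) (hRD : ∀ x, R (D x) = D x) :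
    ((∀ x y, R x = D y → D (x * y) = D x ∧ R (x * y) = R y) ∧
      (∀ x y, R (x * D y) = D (R (x * D y) * y)) ∧
      (∀ x y, D (R x * y) = R (x * D (R x * y)))) ↔
    ((∀ x y, D (x * y) = D (x * D y)) ∧
      (∀ x y, R (x * y) = R (R x * y)) ∧
      (∀ s t, R (s * t) = D (R (s * t) * R t)) ∧
      (∀ s t, D (s * t) = R (D s * D (s * t)))) := by
  constructor
  · rintro ⟨hcat, hl, hr⟩
    refine ⟨fun x y => ?_, fun x y => ?_, fun s t => ?_, fun s t => ?_⟩
    · have h := (hcat (x * D y) (R (x * D y) * y) (hl x y)).1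
      rwa [← mul_assoc, hR, mul_assoc, hD] at h
    · have h := (hcat (x * D (R x * y)) (R x * y) (hr x y).symm).2
      rwa [mul_assoc, hD, ← mul_assoc, hR] at h
    · have h := hl (s * t) (R t)
      rwa [hDR, mul_assoc, hR] at h
    · have h := hr (D s) (s * t)
      rwa [hRD, ← mul_assoc, hD] at h
  · rintro ⟨hl, hr, hRmul, hDmul⟩
    refine ⟨fun x y h => ⟨?_, ?_⟩, fun x y => ?_, fun x y => ?_⟩
    · rw [hl, ← h, hR]
    · rw [hr, h, hD]
    · have h := hRmul x (D y)
      rwa [hRD, ← hl] at h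
    · have h := hDmul (R x) y
      rwa [hDR, ← hr] at h
end

section
/- A cat-semigroup S satisfies the law R(sD(t)) = D(R(s)t) for all s, t if and only if S satisfies the congruence conditions and D(ef) = R(ef) for all e, f in D(S). -/
/-- A cat-semigroup S satisfies R(sD(t)) = D(R(s)t) for all s, t iff
S satisfies the congruence conditions and D(ef) = R(ef) for all e, f in D(S). -/
theorem cat_strong_law_characterisation
    {S : Type*} [Semigroup S] (D R : S → S)
    (hD : ∀ x, D x * x = x) (hR : ∀ x, x * R x = x)
    (hDD : ∀ x, D x * D x = D x) (hDR : ∀ x, D (R x) = R x) (hRD : ∀ x, R (D x) = D x)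
    (hcat : ∀ x y, R x = D y → D (x * y) = D x ∧ R (x * y) = R y) :
    (∀ s t, R (s * D t) = D (R s * t)) ↔
    ((∀ x y, D (x * y) = D (x * D y)) ∧
      (∀ x y, R (x * y) = R (R x * y)) ∧
      (∀ s t, D (D s * D t) = R (D s * D t))) := by
  constructor
  · intro h
    have hDDD : ∀ x, D (D x) = D x := fun x => by
      have := hDR (D x)
      rwa [hRD] at this
    have hRR : ∀ x, R (R x) = R x := fun x => by
      have := hRD (R x)
      rwa [hDR] at this
    have right_proj : ∀ x y, R (x * D y) = R (R x * D y) := fun x y => by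
      rw [h x y, h (R x) y, hRR]
    have left_proj : ∀ x y, D (R x * y) = D (R x * D y) := fun x y => by
      rw [← h x y, ← h x (D y), hDDD]
    have left_reduce : ∀ x y, D (x * y) = D (x * D (R x * y)) := fun x y => by
      have hc : R (x * D (R x * y)) = D (R x * y) := by
        have hRx : R x * R x = R x := by simpa only [hDR] using hDD (R x)
        rw [h, ← mul_assoc, hRx]
      have := (hcat _ _ hc).1
      rwa [mul_assoc, hD, ← mul_assoc, hR] at this
    have right_reduce : ∀ x y, R (x * y) = R (R (x * D y) * y) := fun x y => by
      have hc : R (x * D y) = D (R (x * D y) * y) := by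
        rw [← h (x * D y) y, mul_assoc, hDD]
      have := (hcat (x * D y) (R (x * D y) * y) hc).2
      rwa [← mul_assoc, hR, mul_assoc, hD] at this
    refine ⟨fun x y => ?_, fun x y => ?_, fun s t => ?_⟩
    · rw [left_reduce x y, left_reduce x (D y), left_proj]
    · rw [right_reduce x y, right_reduce (R x) y, right_proj]
    · have := h (D s) (D t)
      rw [hDDD, hRD] at this
      exact this.symm
  · rintro ⟨hl, hr, hp⟩ s t
    rw [hr, hl (R s) t, ← hDR s, hp]
end

section
/- A precat-semigroup S is a cat-semigroup satisfying the strong match-up conditions if and only if S satisfies the congruence conditions, the law D(ef) = R(ef) for all e, f in D(S), and the law sD(t)R(s)t = st for all s, t. -/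
/-- A precat-semigroup S is a cat-semigroup satisfying the strong match-up
conditions iff S satisfies the congruence conditions, D(ef) = R(ef) for all e, f in D(S),
and the law sD(t)R(s)t = st. -/
theorem cat_strong_matchup_characterisation
    {S : Type*} [Semigroup S] (D R : S → S)
    (hD : ∀ x, D x * x = x) (hR : ∀ x, x * R x = x)
    (hDD : ∀ x, D x * D x = D x) (hDR : ∀ x, D (R x) = R x) (hRD : ∀ x, R (D x) = D x) :
    ((∀ x y, R x = D y → D (x * y) = D x ∧ R (x * y) = R y) ∧
      (∀ x y, R (x * D y) = D (R x * y)) ∧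
      (∀ x y, x * y = x * D y * R x * y)) ↔
    ((∀ x y, D (x * y) = D (x * D y)) ∧
      (∀ x y, R (x * y) = R (R x * y)) ∧
      (∀ s t, D (D s * D t) = R (D s * D t)) ∧
      (∀ s t, s * D t * R s * t = s * t)) := by
  have hDD' (x) : D (D x) = D x := by simpa only [hRD] using hDR (D x)
  constructor
  · rintro ⟨hcat, hmatch, hprod⟩
    have hfactor (x y) : x * D y * (R x * y) = x * y := by
      rw [← mul_assoc, ← hprod x y]
    refine ⟨fun x y => ?_, fun x y => ?_, fun s t => ?_, fun s t => (hprod s t).symm⟩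
    · have h := (hcat (x * D y) (R x * y) (hmatch x y)).1
      rwa [hfactor] at h
    · have h := (hcat (x * D y) (R x * y) (hmatch x y)).2
      rwa [hfactor] at h
    · have h := hmatch (D s) (D t)
      rw [hDD', hRD] at h
      exact h.symm
  · rintro ⟨hleft, hright, hproj, hprod⟩
    refine ⟨fun x y hxy => ⟨?_, ?_⟩, fun x y => ?_, fun x y => (hprod x y).symm⟩
    · rw [hleft, ← hxy, hR]
    · rw [hright, hxy, hD]
    · have h := hproj (R x) y
      rw [hDR] at h
      rw [hright, hleft, h]
end

section
/- Let S be a cat-semigroup satisfying the law R(sD(t)) = D(R(s)t) for all s, t. Then the equations sD(R(s)t) = sD(t) and R(sD(t))t = R(s)t hold for all s, t in S if and only if S is localisable. -/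
/-- Let S be a cat-semigroup satisfying R(sD(t)) = D(R(s)t). Then the
equations sD(R(s)t) = sD(t) and R(sD(t))t = R(s)t hold for all s, t iff S is localisable
(i.e., the congruence conditions hold and D(S) is a band). -/
theorem strong_law_args_agree_iff_localisable
    {S : Type*} [Semigroup S] (D R : S → S)
    (hD : ∀ x, D x * x = x) (hR : ∀ x, x * R x = x)
    (hDD : ∀ x, D x * D x = D x) (hDR : ∀ x, D (R x) = R x) (hRD : ∀ x, R (D x) = D x)
    (hcat : ∀ x y, R x = D y → D (x * y) = D x ∧ R (x * y) = R y)
    (hlaw : ∀ s t, R (s * D t) = D (R s * t)) :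
    (∀ s t, s * D (R s * t) = s * D t ∧ R (s * D t) * t = R s * t) ↔
    ((∀ x y, D (x * y) = D (x * D y)) ∧
      (∀ x y, R (x * y) = R (R x * y)) ∧
      (∀ s t, D s * D t = D (D s * D t))) := by
  have hDidem : ∀ x, D (D x) = D x := fun x => by rw [← hRD x, hDR]
  constructor
  · intro h
    have hpair : ∀ x y, D (x * y) = D (x * D y) ∧ R (x * y) = R (R x * y) := by
      intro x y
      have hxy : (x * D y) * (R x * y) = x * y := by
        rw [← (h x y).2, hlaw, ← (h x y).1, mul_assoc, ← mul_assoc (D (R x * y)),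
          hDD, ← mul_assoc, (h x y).1, mul_assoc, hD]
      have hc := hcat (x * D y) (R x * y) (hlaw x y)
      rwa [hxy] at hc
    refine ⟨fun x y => (hpair x y).1, fun x y => (hpair x y).2, fun s t => ?_⟩
    have h₁ : D s * D (D s * D t) = D s * D t := by
      simpa only [hRD, hDidem] using (h (D s) (D t)).1
    have h₂ := (h (D s) (D (D s * D t))).2
    rw [hlaw, hRD, h₁, hDD] at h₂
    exact h₂.symm
  · rintro ⟨hleft, -, hband⟩ s t
    have hp : D (R s * t) = R s * D t := by
      rw [hleft, ← hDR s, ← hband]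
    constructor
    · rw [hp, ← mul_assoc, hR]
    · rw [hlaw, hp, mul_assoc, hD]
end

section
/- A cat-semigroup S in which D(S) is a band satisfies the left match-up condition if and only if S is left semi-localisable (i.e., S satisfies the left congruence condition and the right weak congruence condition). -/
/-- A cat-semigroup S in which D(S) is a band satisfies the left match-up
condition iff S satisfies the left congruence condition and the right weak congruence
condition (i.e., S is left semi-localisable). -/
theorem band_left_matchup_iff_left_semilocalisable
    {S : Type*} [Semigroup S] (D R : S → S)
    (hD : ∀ x, D x * x = x) (hR : ∀ x, x * R x = x)
    (hDD : ∀ x, D x * D x = D x) (hDR : ∀ x, D (R x) = R x) (hRD : ∀ x, R (D x) = D x)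
    (hcat : ∀ x y, R x = D y → D (x * y) = D x ∧ R (x * y) = R y)
    (hband : ∀ s t, D s * D t = D (D s * D t)) :
    (∀ x y, R (x * D y) = D (R (x * D y) * y)) ↔
    ((∀ x y, D (x * y) = D (x * D y)) ∧
      (∀ x y, R (x * y) = R (R (x * D y) * y))) := by
  constructor
  · intro h
    have key (x y) : D (x * y) = D (x * D y) ∧ R (x * y) = R (R (x * D y) * y) := by
      have hxy : x * D y * (R (x * D y) * y) = x * y := by
        rw [← mul_assoc, hR, mul_assoc, hD]
      simpa only [hxy] using hcat (x * D y) (R (x * D y) * y) (h x y)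
    exact ⟨fun x y => (key x y).1, fun x y => (key x y).2⟩
  · rintro ⟨hl, hr⟩ x y
    have hDy : D (D y) = D y := by
      rw [← hRD y, hDR]
    have hb : R (x * D y) * D y = D (R (x * D y) * D y) := by
      simpa only [hDR] using hband (R (x * D y)) y
    have hRb : R (R (x * D y) * D y) = R (x * D y) * D y := by
      rw [hb, hRD]
    have he : R (x * D y) = R (x * D y) * D y := by
      have h := hr x (D y)
      rwa [hDy, hRb] at h
    rw [hl, ← hb, ← he]
end

section
/- For a cat-semigroup S, the following are equivalent: (1) S is localisable; (2) S satisfies the strong match-up conditions and D(S) is a band; (3) S satisfies the match-up conditions and D(S) is a band. -/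
/-- For a cat-semigroup S, the following are equivalent:
(1) S is localisable; (2) S satisfies the strong match-up conditions and D(S) is a band;
(3) S satisfies the match-up conditions and D(S) is a band. -/
theorem localisable_three_way_equivalence
    {S : Type*} [Semigroup S] (D R : S → S)
    (hD : ∀ x, D x * x = x) (hR : ∀ x, x * R x = x)
    (hDD : ∀ x, D x * D x = D x) (hDR : ∀ x, D (R x) = R x) (hRD : ∀ x, R (D x) = D x)
    (hcat : ∀ x y, R x = D y → D (x * y) = D x ∧ R (x * y) = R y) :
    (((∀ x y, D (x * y) = D (x * D y)) ∧
        (∀ x y, R (x * y) = R (R x * y)) ∧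
        (∀ s t, D s * D t = D (D s * D t))) ↔
      ((∀ x y, R (x * D y) = D (R x * y)) ∧
        (∀ x y, x * y = x * D y * R x * y) ∧
        (∀ s t, D s * D t = D (D s * D t)))) ∧
    (((∀ x y, R (x * D y) = D (R x * y)) ∧
        (∀ x y, x * y = x * D y * R x * y) ∧
        (∀ s t, D s * D t = D (D s * D t))) ↔
      ((∀ x y, R (x * D y) = D (R (x * D y) * y)) ∧
        (∀ x y, D (R x * y) = R (x * D (R x * y))) ∧
        (∀ s t, D s * D t = D (D s * D t)))) := by
  have hDid : ∀ x, D (D x) = D x := fun x => by rw [← hRD x, hDR]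
  have localisable_strong :
      ((∀ x y, D (x * y) = D (x * D y)) ∧ (∀ x y, R (x * y) = R (R x * y)) ∧
        (∀ s t, D s * D t = D (D s * D t))) →
      ((∀ x y, R (x * D y) = D (R x * y)) ∧ (∀ x y, x * y = x * D y * R x * y) ∧
        (∀ s t, D s * D t = D (D s * D t))) := by
    rintro ⟨hl, hr, hb⟩
    have hRb : ∀ x y, R x * D y = D (R x * D y) := fun x y => by
      have h := hb (R x) y
      rwa [hDR] at h
    refine ⟨fun x y => ?_, fun x y => ?_, hb⟩
    · rw [hr, hl (R x) y, hRb x y, hRD, hDid]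
    · have hidem : R x * D y * (R x * D y) = R x * D y := by
        rw [hRb x y]
        exact hDD _
      calc x * y = x * R x * (D y * y) := by rw [hR, hD]
        _ = x * (R x * D y) * y := by simp only [mul_assoc]
        _ = x * (R x * D y * (R x * D y)) * y := by rw [hidem]
        _ = x * R x * D y * R x * (D y * y) := by simp only [mul_assoc]
        _ = x * D y * R x * y := by rw [hR, hD]
  refine ⟨⟨localisable_strong, ?_⟩, ?_, ?_⟩
  · rintro ⟨hm, hf, hb⟩
    have hfactor : ∀ x y, x * y = x * D y * (R x * y) := fun x y => by
      rw [← mul_assoc, ← hf]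
    refine ⟨fun x y => ?_, fun x y => ?_, hb⟩
    · rw [hfactor x y, (hcat _ _ (hm x y)).1]
    · rw [hfactor x y, (hcat _ _ (hm x y)).2]
  · rintro ⟨hm, -, hb⟩
    refine ⟨fun x y => ?_, fun x y => ?_, hb⟩
    · rw [← hm, mul_assoc, hDD]
    · have hRR : R x * R x = R x := by
        have h := hDD (R x)
        rwa [hDR] at h
      rw [hm, ← mul_assoc, hRR]
  · rintro ⟨hl, hr, hb⟩
    refine localisable_strong ⟨fun x y => ?_, fun x y => ?_, hb⟩
    · have h := (hcat (x * D y) (R (x * D y) * y) (hl x y)).1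
      rwa [← mul_assoc, hR, mul_assoc, hD] at h
    · have h := (hcat (x * D (R x * y)) (R x * y) (hr x y).symm).2
      rwa [mul_assoc, hD, ← mul_assoc, hR] at h
end

section
/- If S is a D-ample precat-semigroup, then D(S) is a band; that is, ef = D(ef) for all e, f in D(S). -/
/-- If S is a D-ample precat-semigroup, then D(S) is a band;
that is, ef = D(ef) for all e, f in D(S). -/
theorem Dample_implies_band
    {S : Type*} [Semigroup S] (D R : S → S)
    (hD : ∀ x, D x * x = x) (hR : ∀ x, x * R x = x)
    (hDD : ∀ x, D x * D x = D x) (hDR : ∀ x, D (R x) = R x) (hRD : ∀ x, R (D x) = D x)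
    (hample : ∀ x y, x * D y = D (x * y) * x) :
    ∀ s t : S, D s * D t = D (D s * D t) := by
  intro s t
  have hDidem : ∀ x, D (D x) = D x := fun x => by
    have h := hDR (D x)
    rwa [hRD] at h
  have h₁ : D s * D t = D (D s * D t) * D s := by
    simpa only [hDidem] using hample (D s) (D t)
  have h₂ : D (D s * D t) * D s = D (D (D s * D t) * D s) * D (D s * D t) := by
    simpa only [hDidem] using hample (D (D s * D t)) (D s)
  rw [← h₁, hDD] at h₂
  exact h₂
end

section
/- A precat-semigroup S is a left restriction semigroup with range if and only if S is left semi-localisable, D-ample, and the band D(S) is a semilattice (i.e., ef = fe for all e, f in D(S)). -/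
/-- A precat-semigroup S is a left restriction semigroup with range iff
S is left semi-localisable, D-ample, and the band D(S) is a semilattice. -/
theorem left_restriction_with_range_characterisation
    {S : Type*} [Semigroup S] (D R : S → S)
    (hD : ∀ x, D x * x = x) (hR : ∀ x, x * R x = x)
    (hDD : ∀ x, D x * D x = D x) (hDR : ∀ x, D (R x) = R x) (hRD : ∀ x, R (D x) = D x) :
    ((∀ x y, D x * D y = D y * D x) ∧
      (∀ x y, D (D x * y) = D x * D y) ∧
      (∀ x y, x * D y = D (x * y) * x) ∧
      (∀ x y, R (x * y) * R y = R (x * y))) ↔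
    ((∀ x y, D (x * y) = D (x * D y)) ∧
      (∀ x y, R (x * y) = R (R (x * D y) * y)) ∧
      (∀ s t, D s * D t = D (D s * D t)) ∧
      (∀ x y, x * D y = D (x * y) * x) ∧
      (∀ s t, D s * D t = D t * D s)) := by
  have hDDx : ∀ x, D (D x) = D x := fun x => by
    have h := hDR (D x)
    rwa [hRD] at h
  constructor
  · rintro ⟨hcomm, hmul, hample, hrange⟩
    have hleft : ∀ x y, D (x * y) * D x = D (x * y) := fun x y => by
      rw [hcomm, ← hmul, ← mul_assoc, hD]
    have hcong : ∀ x y, D (x * y) = D (x * D y) := fun x y => by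
      rw [hample, hmul, hleft]
    -- The right weak congruence condition for `u = x * D y`, which satisfies `u * D y = u`.
    have hweak : ∀ u y, u * D y = u → R (u * y) = R (R u * y) := fun u y hu => by
      have hle : R (u * y) * R (R u * y) = R (u * y) := by
        have h := hrange u (R u * y)
        rwa [← mul_assoc, hR] at h
      have hfix : u * D (y * R (u * y)) = u := by
        rw [hample, ← mul_assoc, hR, ← hample, hu]
      have hRfix : R u * D (y * R (u * y)) = R u := by
        have h := hrange u (D (y * R (u * y)))
        rwa [hfix, hRD] at h
      have habsorb : R u * y * R (u * y) = R u * y := by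
        have h := hample y (R (u * y))
        rw [hDR] at h
        rw [mul_assoc, h, ← mul_assoc, hRfix]
      have hge : R (R u * y) * R (u * y) = R (R u * y) := by
        have h := hrange (R u * y) (R (u * y))
        have hRR : R (R (u * y)) = R (u * y) := by
          rw [← hDR (u * y), hRD]
        rwa [habsorb, hRR] at h
      have h := hcomm (R (u * y)) (R (R u * y))
      rw [hDR, hDR] at h
      rw [← hle, h, hge]
    refine ⟨hcong, fun x y => ?_, fun s t => by rw [hmul, hDDx], hample, hcomm⟩
    have h := hweak (x * D y) y (by rw [mul_assoc, hDD])
    rwa [mul_assoc, hD] at h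
  · rintro ⟨hcong, hweak, hband, hample, hcomm⟩
    refine ⟨hcomm, fun x y => by rw [hcong, ← hband], hample, fun x y => ?_⟩
    have hproj : R (R (x * y) * R y) = R (x * y) * R y := by
      have h := hband (R (x * y)) (R y)
      rw [hDR, hDR] at h
      rw [h, hRD]
    have h := hweak (x * y) (R y)
    rw [hDR, mul_assoc, hR, hproj] at h
    exact h.symm
end

section
/- A cat-semigroup S satisfies the match-up conditions if and only if the following hold: for all s, t in S with R(s) = D(t) and all e in D(S), R(es) = D(R(es)t), e(st) = (es)(R(es)t), D(te) = R(sD(te)), and (st)e = (sD(te))(te). (These conditions say exactly that the category with biaction determined by S satisfies (TC4).) -/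
/-- A cat-semigroup S satisfies the match-up conditions iff the category
with biaction determined by S satisfies (TC4): for all s, t with R(s) = D(t) and all
e in D(S), R(es) = D(R(es)t), e(st) = (es)(R(es)t), D(te) = R(sD(te)), and
(st)e = (sD(te))(te). -/
theorem matchup_iff_TC4
    {S : Type*} [Semigroup S] (D R : S → S)
    (hD : ∀ x, D x * x = x) (hR : ∀ x, x * R x = x)
    (hDD : ∀ x, D x * D x = D x) (hDR : ∀ x, D (R x) = R x) (hRD : ∀ x, R (D x) = D x)
    (hcat : ∀ x y, R x = D y → D (x * y) = D x ∧ R (x * y) = R y) :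
    ((∀ x y, R (x * D y) = D (R (x * D y) * y)) ∧
      (∀ x y, D (R x * y) = R (x * D (R x * y)))) ↔
    (∀ s t : S, R s = D t → ∀ u : S,
      R (D u * s) = D (R (D u * s) * t) ∧
      D u * (s * t) = (D u * s) * (R (D u * s) * t) ∧
      D (t * D u) = R (s * D (t * D u)) ∧
      (s * t) * D u = (s * D (t * D u)) * (t * D u)) := by
  constructor
  · rintro ⟨hl, hr⟩ s t hst u
    have hs : D u * s * D t = D u * s := by rw [← hst, mul_assoc, hR]
    have ht : R s * (t * D u) = t * D u := by rw [hst, ← mul_assoc, hD]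
    refine ⟨?_, ?_, ?_, ?_⟩
    · simpa only [hs] using hl (D u * s) t
    · rw [← mul_assoc (D u * s), hR, mul_assoc]
    · simpa only [ht] using hr s (t * D u)
    · rw [mul_assoc s (D _), hD, mul_assoc]
  · intro h
    have hDeq (x y : S) : D (R x * y) = D (R x * D y) := by
      obtain ⟨h1, h2, -, -⟩ := h (D y) y (hRD y) (R x)
      rw [hDR] at h1 h2
      rw [hD] at h2
      rw [h2]
      exact (hcat _ _ h1).1
    have hReq (x y : S) : R (x * D y) = R (R x * D y) := by
      obtain ⟨-, -, h3, h4⟩ := h x (R x) (hDR x).symm y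
      rw [hR] at h4
      rw [h4]
      exact (hcat _ _ h3.symm).2
    constructor
    · intro x y
      have h1 := (h (D y) y (hRD y) (R x)).1
      rwa [hDR, ← hReq] at h1
    · intro x y
      have h3 := (h x (R x) (hDR x).symm y).2.2.1
      rwa [← hDeq] at h3
end

section
/- A cat-semigroup S satisfies the left match-up condition if and only if S satisfies the law R(st) = D(R(st)R(t)) for all s, t, and in addition: for all s, t in S with R(s) = D(t) and all e in D(S), R(es) = D(R(es)t) and e(st) = (es)(R(es)t). (The latter conditions say exactly that the category with biaction determined by S satisfies (TC4a).) -/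
/-- A cat-semigroup S satisfies the left match-up condition iff it
satisfies the law R(st) = D(R(st)R(t)) and the category with biaction determined by S
satisfies (TC4a): for all s, t with R(s) = D(t) and all e in D(S),
R(es) = D(R(es)t) and e(st) = (es)(R(es)t). -/
theorem left_matchup_iff_law_and_TC4a
    {S : Type*} [Semigroup S] (D R : S → S)
    (hD : ∀ x, D x * x = x) (hR : ∀ x, x * R x = x)
    (hDD : ∀ x, D x * D x = D x) (hDR : ∀ x, D (R x) = R x) (hRD : ∀ x, R (D x) = D x)
    (hcat : ∀ x y, R x = D y → D (x * y) = D x ∧ R (x * y) = R y) :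
    (∀ x y, R (x * D y) = D (R (x * D y) * y)) ↔
    ((∀ s t, R (s * t) = D (R (s * t) * R t)) ∧
      (∀ s t : S, R s = D t → ∀ u : S,
        R (D u * s) = D (R (D u * s) * t) ∧
        D u * (s * t) = (D u * s) * (R (D u * s) * t))) := by
  constructor
  · intro h
    refine ⟨fun s t => ?_, fun s t hst u => ⟨?_, ?_⟩⟩
    · have h₁ := h (s * t) (R t)
      rwa [hDR, mul_assoc, hR] at h₁
    · have h₁ := h (D u * s) t
      rwa [← hst, mul_assoc, hR] at h₁
    · rw [← mul_assoc (D u * s), hR, mul_assoc]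
  · rintro ⟨hlaw, hTC⟩ x y
    have hf := hlaw x (D y)
    rw [hRD] at hf
    obtain ⟨hmatch, hact⟩ := hTC (D y) y (hRD y) (R (x * D y))
    rw [hDR] at hmatch hact
    rw [hD] at hact
    rw [hact, (hcat _ _ hmatch).1]
    exact hf
end

section
/- If C is a category with biaction satisfying (TC4a), then for all s in C and all e in C⁰, D(e|s) = D(e|D(s)). -/
/-- An object-free small category: a set with a partial composition (given by a
composition defined on pairs with matching range/domain identities) and unary
operations `D`, `R`, equipped with a biaction of the identities (the elements of the
form `D x`, equivalently those `e` with `D e = e`) via a left action `la` and a right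
action `ra`, satisfying (TC1), (TC2) and (TC6). -/
structure BiactionCat (C : Type*) where
  D : C → C
  R : C → C
  comp : (x y : C) → R x = D y → C
  rd : ∀ x, R (D x) = D x
  dr : ∀ x, D (R x) = R x
  comp_id_left : ∀ x, comp (D x) x (rd x) = x
  comp_id_right : ∀ x, comp x (R x) (dr x).symm = x
  d_comp : ∀ x y (h : R x = D y), D (comp x y h) = D x
  r_comp : ∀ x y (h : R x = D y), R (comp x y h) = R y
  assoc : ∀ x y z (h1 : R x = D y) (h2 : R y = D z),
    comp (comp x y h1) z ((r_comp x y h1).trans h2) =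
      comp x (comp y z h2) (h1.trans (d_comp y z h2).symm)
  la : C → C → C
  ra : C → C → C
  tc1 : ∀ e f, D e = e → D f = f → la e f = ra e f
  tc2_left : ∀ a, la (D a) a = a
  tc2_right : ∀ a, ra a (R a) = a
  tc6 : ∀ e f a, D e = e → D f = f → ra (la e a) f = la e (ra a f)

namespace BiactionCat

variable {C : Type*} (Γ : BiactionCat C)

/-- (TC4a): whenever `a ∘ b` is defined, for every identity `e` the product
`(e|a) ∘ (R(e|a)|b)` is defined and equals `e|(a ∘ b)`. -/
def TC4a : Prop :=
  ∀ a b (h : Γ.R a = Γ.D b) e, Γ.D e = e →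
    ∃ h2 : Γ.R (Γ.la e a) = Γ.D (Γ.la (Γ.R (Γ.la e a)) b),
      Γ.comp (Γ.la e a) (Γ.la (Γ.R (Γ.la e a)) b) h2 = Γ.la e (Γ.comp a b h)

/-- (TC4b): whenever `a ∘ b` is defined, for every identity `e` the product
`(a|D(b|e)) ∘ (b|e)` is defined and equals `(a ∘ b)|e`. -/
def TC4b : Prop :=
  ∀ a b (h : Γ.R a = Γ.D b) e, Γ.D e = e →
    ∃ h2 : Γ.R (Γ.ra a (Γ.D (Γ.ra b e))) = Γ.D (Γ.ra b e),
      Γ.comp (Γ.ra a (Γ.D (Γ.ra b e))) (Γ.ra b e) h2 = Γ.ra (Γ.comp a b h) e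

/-- (TC4a'): whenever `a ∘ b` is defined, for every identity `e` the product
`((e|a)|D(R(e|a)|b)) ∘ (R(e|a)|b)` is defined and equals `e|(a ∘ b)`. -/
def TC4a' : Prop :=
  ∀ a b (h : Γ.R a = Γ.D b) e, Γ.D e = e →
    ∃ h2 : Γ.R (Γ.ra (Γ.la e a) (Γ.D (Γ.la (Γ.R (Γ.la e a)) b))) =
        Γ.D (Γ.la (Γ.R (Γ.la e a)) b),
      Γ.comp (Γ.ra (Γ.la e a) (Γ.D (Γ.la (Γ.R (Γ.la e a)) b)))
        (Γ.la (Γ.R (Γ.la e a)) b) h2 = Γ.la e (Γ.comp a b h)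

/-- (TC4b'): whenever `a ∘ b` is defined, for every identity `e` the product
`(a|D(b|e)) ∘ (R(a|D(b|e))|(b|e))` is defined and equals `(a ∘ b)|e`. -/
def TC4b' : Prop :=
  ∀ a b (h : Γ.R a = Γ.D b) e, Γ.D e = e →
    ∃ h2 : Γ.R (Γ.ra a (Γ.D (Γ.ra b e))) =
        Γ.D (Γ.la (Γ.R (Γ.ra a (Γ.D (Γ.ra b e)))) (Γ.ra b e)),
      Γ.comp (Γ.ra a (Γ.D (Γ.ra b e)))
        (Γ.la (Γ.R (Γ.ra a (Γ.D (Γ.ra b e)))) (Γ.ra b e)) h2 = Γ.ra (Γ.comp a b h) e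

/-- (TC4) is (TC4a) together with (TC4b). -/
def TC4 : Prop := Γ.TC4a ∧ Γ.TC4b

/-- (TC4L) is (TC4a) together with (TC4b'). -/
def TC4L : Prop := Γ.TC4a ∧ Γ.TC4b'

/-- (TC4R) is (TC4a') together with (TC4b). -/
def TC4R : Prop := Γ.TC4a' ∧ Γ.TC4b

/-- (LMU): `R(s|D(t)) = D(R(s|D(t))|t)` for all `s, t`. -/
def LMU : Prop := ∀ s t, Γ.R (Γ.ra s (Γ.D t)) = Γ.D (Γ.la (Γ.R (Γ.ra s (Γ.D t))) t)

/-- (RMU): `D(R(s)|t) = R(s|D(R(s)|t))` for all `s, t`. -/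
def RMU : Prop := ∀ s t, Γ.D (Γ.la (Γ.R s) t) = Γ.R (Γ.ra s (Γ.D (Γ.la (Γ.R s) t)))

/-- The total extension of the partial composition: `pcomp x y = x ∘ y` when the
product is defined, and junk otherwise. -/
noncomputable def pcomp (x y : C) : C :=
  haveI := Classical.dec (Γ.R x = Γ.D y)
  if h : Γ.R x = Γ.D y then Γ.comp x y h else x

/-- The (left) pseudoproduct `s ⊗ t = (s|D(t)) ∘ (R(s|D(t))|t)`, expressed via the
total extension `pcomp` of the partial composition (the product is genuinely defined
whenever (LMU) holds, in particular under (TC4)). -/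
noncomputable def otimes (s t : C) : C :=
  Γ.pcomp (Γ.ra s (Γ.D t)) (Γ.la (Γ.R (Γ.ra s (Γ.D t))) t)

end BiactionCat

/-- If C is a category with biaction satisfying (TC4a), then for all
s in C and all e in C⁰, D(e|s) = D(e|D(s)). -/
theorem TC4a_implies_d_la_d
    {C : Type*} (Γ : BiactionCat C) (h : Γ.TC4a) :
    ∀ (s e : C), Γ.D e = e → Γ.D (Γ.la e s) = Γ.D (Γ.la e (Γ.D s)) := by
  intro s e he
  obtain ⟨hdef, hcomp⟩ := h (Γ.D s) s (Γ.rd s) e he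
  rw [Γ.comp_id_left] at hcomp
  rw [← hcomp, Γ.d_comp]
end

section
/- A category with biaction C satisfies (TC4) if and only if it satisfies (TC4L) and (TC4R); and in that case C also satisfies (LMU) and (RMU). -/
namespace BiactionCat

variable {C : Type*} {Γ : BiactionCat C}

theorem TC4a.tc4a' (ha : Γ.TC4a) : Γ.TC4a' := by
  intro a b h e he
  obtain ⟨h1, h2⟩ := ha a b h e he
  have key : Γ.ra (Γ.la e a) (Γ.D (Γ.la (Γ.R (Γ.la e a)) b)) = Γ.la e a := by
    rw [← h1, Γ.tc2_right]
  simp only [key]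
  exact ⟨h1, h2⟩

theorem TC4b.tc4b' (hb : Γ.TC4b) : Γ.TC4b' := by
  intro a b h e he
  obtain ⟨h1, h2⟩ := hb a b h e he
  have key : Γ.la (Γ.R (Γ.ra a (Γ.D (Γ.ra b e)))) (Γ.ra b e) = Γ.ra b e := by
    rw [h1, Γ.tc2_left]
  simp only [key]
  exact ⟨h1, h2⟩

theorem D_D (Γ : BiactionCat C) (x : C) : Γ.D (Γ.D x) = Γ.D x := by
  rw [← Γ.rd x, Γ.dr]

theorem R_R (Γ : BiactionCat C) (x : C) : Γ.R (Γ.R x) = Γ.R x := by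
  rw [← Γ.dr x, Γ.rd]

theorem TC4a.D_la (ha : Γ.TC4a) {e : C} (he : Γ.D e = e) (t : C) :
    Γ.D (Γ.la e t) = Γ.D (Γ.la e (Γ.D t)) := by
  obtain ⟨_, h⟩ := ha (Γ.D t) t (Γ.rd t) e he
  rw [Γ.comp_id_left] at h
  rw [← h, Γ.d_comp]

theorem TC4b.R_ra (hb : Γ.TC4b) {e : C} (he : Γ.D e = e) (s : C) :
    Γ.R (Γ.ra s e) = Γ.R (Γ.ra (Γ.R s) e) := by
  obtain ⟨_, h⟩ := hb s (Γ.R s) (Γ.dr s).symm e he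
  rw [Γ.comp_id_right] at h
  rw [← h, Γ.r_comp]

theorem TC4.lmu (h : Γ.TC4) : Γ.LMU := by
  intro s t
  obtain ⟨h1, -⟩ := h.1 (Γ.D t) (Γ.D t) ((Γ.rd t).trans (Γ.D_D t).symm) (Γ.R s) (Γ.dr s)
  rw [h.1.D_la (Γ.dr _), h.2.R_ra (Γ.D_D t), ← Γ.tc1 _ _ (Γ.dr s) (Γ.D_D t)]
  exact h1

theorem TC4.rmu (h : Γ.TC4) : Γ.RMU := by
  intro s t
  obtain ⟨h1, -⟩ := h.2 (Γ.R s) (Γ.R s) ((Γ.R_R s).trans (Γ.dr s).symm) (Γ.D t) (Γ.D_D t)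
  rw [h.2.R_ra (Γ.D_D _), h.1.D_la (Γ.dr s), Γ.tc1 _ _ (Γ.dr s) (Γ.D_D t)]
  exact h1.symm

end BiactionCat

/-- A category with biaction satisfies (TC4) iff it satisfies (TC4L) and
(TC4R); and in that case it also satisfies (LMU) and (RMU). -/
theorem TC4_iff_TC4L_and_TC4R
    {C : Type*} (Γ : BiactionCat C) :
    (Γ.TC4 ↔ (Γ.TC4L ∧ Γ.TC4R)) ∧ (Γ.TC4 → (Γ.LMU ∧ Γ.RMU)) := by
  exact ⟨⟨fun h => ⟨⟨h.1, h.2.tc4b'⟩, h.1.tc4a', h.2⟩, fun h => ⟨h.1.1, h.2.2⟩⟩,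
    fun h => ⟨h.lmu, h.rmu⟩⟩
end

section
/- If C is a category with biaction satisfying (LMU) and (TC4L), then for all x in C and all e in C⁰, x|e = (x|e)|e. -/
namespace BiactionCat

variable {C : Type*} (Γ : BiactionCat C)

theorem ra_ra_of_identity {f e : C} (hf : Γ.D f = f) (he : Γ.D e = e) :
    Γ.ra (Γ.ra f e) e = Γ.ra f e := by
  have hee : Γ.ra e e = e := by
    rw [← Γ.tc1 e e he he]
    simpa only [he] using Γ.tc2_left e
  rw [← Γ.tc1 f e hf he, Γ.tc6 f e e hf he, hee]

variable {Γ}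

/-- Under (TC4b'), if `e` fixes the second factor of a product, it fixes the product. -/
theorem TC4b'.ra_comp_of_ra_right (h4 : Γ.TC4b') {p q e : C} (h : Γ.R p = Γ.D q)
    (he : Γ.D e = e) (hq : Γ.ra q e = q) : Γ.ra (Γ.comp p q h) e = Γ.comp p q h := by
  obtain ⟨h', heq⟩ := h4 p q h e he
  have hp : Γ.ra p (Γ.D q) = p := by rw [← h, Γ.tc2_right]
  have hl : Γ.la (Γ.R p) q = q := by rw [h, Γ.tc2_left]
  rw [← heq]
  simp only [hq, hp, hl]

theorem TC4b'.ra_ra (h4 : Γ.TC4b') (x : C) {e : C} (he : Γ.D e = e) :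
    Γ.ra (Γ.ra x e) e = Γ.ra x e := by
  obtain ⟨h, heq⟩ := h4 x (Γ.R x) (Γ.dr x).symm e he
  rw [Γ.comp_id_right] at heq
  rw [← heq]
  exact h4.ra_comp_of_ra_right h he <| by
    rw [Γ.tc6 _ _ _ (Γ.dr _) he, Γ.ra_ra_of_identity (Γ.dr x) he]

end BiactionCat

/-- If C is a category with biaction satisfying (LMU) and (TC4L), then
for all x in C and all e in C⁰, x|e = (x|e)|e. -/
theorem LMU_TC4L_right_action_idempotent
    {C : Type*} (Γ : BiactionCat C) (hlmu : Γ.LMU) (h4l : Γ.TC4L) :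
    ∀ (x e : C), Γ.D e = e → Γ.ra x e = Γ.ra (Γ.ra x e) e := by
  intro x e he
  exact (h4l.2.ra_ra x he).symm
end

section
/- In a category with biaction C satisfying (TC4), for all s, t in C the left and right pseudoproducts coincide and are given by the triple product: s ⊗_l t = s ⊗_r t = (s|D(R(s)|D(t))) ∘ (R(s)|D(t)) ∘ (R(R(s)|D(t))|t). -/
namespace BiactionCat

variable {C : Type*} (Γ : BiactionCat C)

theorem comp_congr {x x' y y' : C} (hx : x = x') (hy : y = y') (h : Γ.R x = Γ.D y)
    (h' : Γ.R x' = Γ.D y') : Γ.comp x y h = Γ.comp x' y' h' := by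
  subst hx hy
  rfl

theorem d_d (x : C) : Γ.D (Γ.D x) = Γ.D x := by
  rw [← Γ.rd x, Γ.dr, Γ.rd]

/-- Under (TC4b), `s|D(t)` factors as `(s|D(R(s)|D(t))) ∘ (R(s)|D(t))`. -/
theorem TC4b.ra_d_factor {Γ : BiactionCat C} (hb : Γ.TC4b) (s t : C) :
    ∃ h : Γ.R (Γ.ra s (Γ.D (Γ.la (Γ.R s) (Γ.D t)))) = Γ.D (Γ.la (Γ.R s) (Γ.D t)),
      Γ.comp (Γ.ra s (Γ.D (Γ.la (Γ.R s) (Γ.D t)))) (Γ.la (Γ.R s) (Γ.D t)) h =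
        Γ.ra s (Γ.D t) := by
  have key := hb s (Γ.R s) (Γ.dr s).symm (Γ.D t) (Γ.d_d t)
  rwa [Γ.comp_id_right, ← Γ.tc1 _ _ (Γ.dr s) (Γ.d_d t)] at key

/-- Under (TC4a), `R(s)|t` factors as `(R(s)|D(t)) ∘ (R(R(s)|D(t))|t)`. -/
theorem TC4a.la_r_factor {Γ : BiactionCat C} (ha : Γ.TC4a) (s t : C) :
    ∃ h : Γ.R (Γ.la (Γ.R s) (Γ.D t)) = Γ.D (Γ.la (Γ.R (Γ.la (Γ.R s) (Γ.D t))) t),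
      Γ.comp (Γ.la (Γ.R s) (Γ.D t)) (Γ.la (Γ.R (Γ.la (Γ.R s) (Γ.D t))) t) h =
        Γ.la (Γ.R s) t := by
  have key := ha (Γ.D t) t (Γ.rd t) (Γ.R s) (Γ.dr s)
  rwa [Γ.comp_id_left] at key

end BiactionCat

/-- In a category with biaction satisfying (TC4), for all s, t the left
and right pseudoproducts coincide and are given by the triple product:
s ⊗_l t = s ⊗_r t = (s|D(R(s)|D(t))) ∘ (R(s)|D(t)) ∘ (R(R(s)|D(t))|t). -/
theorem TC4_pseudoproducts_coincide
    {C : Type*} (Γ : BiactionCat C) (h4 : Γ.TC4) :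
    ∀ s t : C,
      ∃ (hl : Γ.R (Γ.ra s (Γ.D t)) = Γ.D (Γ.la (Γ.R (Γ.ra s (Γ.D t))) t))
        (hr : Γ.R (Γ.ra s (Γ.D (Γ.la (Γ.R s) t))) = Γ.D (Γ.la (Γ.R s) t))
        (h1 : Γ.R (Γ.ra s (Γ.D (Γ.la (Γ.R s) (Γ.D t)))) = Γ.D (Γ.la (Γ.R s) (Γ.D t)))
        (h2 : Γ.R (Γ.comp (Γ.ra s (Γ.D (Γ.la (Γ.R s) (Γ.D t)))) (Γ.la (Γ.R s) (Γ.D t)) h1) =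
          Γ.D (Γ.la (Γ.R (Γ.la (Γ.R s) (Γ.D t))) t)),
        Γ.comp (Γ.ra s (Γ.D t)) (Γ.la (Γ.R (Γ.ra s (Γ.D t))) t) hl =
          Γ.comp (Γ.ra s (Γ.D (Γ.la (Γ.R s) t))) (Γ.la (Γ.R s) t) hr ∧
        Γ.comp (Γ.ra s (Γ.D t)) (Γ.la (Γ.R (Γ.ra s (Γ.D t))) t) hl =
          Γ.comp (Γ.comp (Γ.ra s (Γ.D (Γ.la (Γ.R s) (Γ.D t)))) (Γ.la (Γ.R s) (Γ.D t)) h1)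
            (Γ.la (Γ.R (Γ.la (Γ.R s) (Γ.D t))) t) h2 := by
  intro s t
  obtain ⟨h1, e1⟩ := h4.2.ra_d_factor s t
  obtain ⟨h3, e2⟩ := h4.1.la_r_factor s t
  have hR : Γ.R (Γ.ra s (Γ.D t)) = Γ.R (Γ.la (Γ.R s) (Γ.D t)) := by
    rw [← e1, Γ.r_comp]
  have hD : Γ.D (Γ.la (Γ.R s) t) = Γ.D (Γ.la (Γ.R s) (Γ.D t)) := by
    rw [← e2, Γ.d_comp]
  have hl : Γ.R (Γ.ra s (Γ.D t)) = Γ.D (Γ.la (Γ.R (Γ.ra s (Γ.D t))) t) := by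
    rw [hR, ← h3]
  have hr : Γ.R (Γ.ra s (Γ.D (Γ.la (Γ.R s) t))) = Γ.D (Γ.la (Γ.R s) t) := by
    rw [hD, h1]
  have triple := Γ.comp_congr e1.symm (congrArg (Γ.la · t) hR) hl ((Γ.r_comp _ _ h1).trans h3)
  refine ⟨hl, hr, h1, (Γ.r_comp _ _ h1).trans h3, ?_, triple⟩
  rw [triple, Γ.assoc _ _ _ h1 h3]
  exact Γ.comp_congr (by rw [hD]) e2 _ _
end

section
/- Suppose a category with biaction C satisfies (TC4) and (SMU). Then for all s, t in C, the product (s|D(t)) ∘ (R(s)|t) is defined and s ⊗ t = (s|D(t)) ∘ (R(s)|t). -/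
namespace BiactionCat

variable {C : Type*} (Γ : BiactionCat C)

theorem pcomp_of_eq {x y : C} (h : Γ.R x = Γ.D y) : Γ.pcomp x y = Γ.comp x y h := by
  simp only [pcomp, dif_pos h]

/-- An idempotent shared by the end of one factor and the start of the next is absorbed. -/
theorem comp_comp_comp_of_idem {a x b : C} (hax : Γ.R a = Γ.D x) (hxx : Γ.R x = Γ.D x)
    (hxb : Γ.R x = Γ.D b) (idem : Γ.comp x x hxx = x)
    (h : Γ.R (Γ.comp a x hax) = Γ.D (Γ.comp x b hxb))
    (h' : Γ.R (Γ.comp a x hax) = Γ.D b) :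
    Γ.comp (Γ.comp a x hax) (Γ.comp x b hxb) h = Γ.comp (Γ.comp a x hax) b h' := by
  have h1 := Γ.assoc (Γ.comp a x hax) x b ((Γ.r_comp a x hax).trans hxx) hxb
  have h2 := Γ.assoc a x x hax hxx
  simp only [idem] at h2
  simp only [h2] at h1
  exact h1.symm

end BiactionCat

/-- Suppose a category with biaction C satisfies (TC4) and (SMU), where
(SMU1) is D(R(s)|t) = R(s|D(t)) for all s, t and (SMU2) is (e|f) ∘ (e|f) = e|f for all
e, f in C⁰.  Then for all s, t the product (s|D(t)) ∘ (R(s)|t) is defined and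
s ⊗ t = (s|D(t)) ∘ (R(s)|t). -/
theorem TC4_SMU_pseudoproduct_simple_form
    {C : Type*} (Γ : BiactionCat C) (h4 : Γ.TC4)
    (smu1 : ∀ s t : C, Γ.D (Γ.la (Γ.R s) t) = Γ.R (Γ.ra s (Γ.D t)))
    (smu2 : ∀ e f : C, Γ.D e = e → Γ.D f = f →
      ∃ h : Γ.R (Γ.la e f) = Γ.D (Γ.la e f),
        Γ.comp (Γ.la e f) (Γ.la e f) h = Γ.la e f) :
    ∀ s t : C,
      ∃ h : Γ.R (Γ.ra s (Γ.D t)) = Γ.D (Γ.la (Γ.R s) t),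
        Γ.comp (Γ.ra s (Γ.D t)) (Γ.la (Γ.R s) t) h = Γ.otimes s t := by
  intro s t
  have hid : Γ.D (Γ.D t) = Γ.D t := by
    simpa only [Γ.rd] using Γ.dr (Γ.D t)
  obtain ⟨hxx, idem⟩ := smu2 (Γ.R s) (Γ.D t) (Γ.dr s) hid
  obtain ⟨hxb, hb⟩ := h4.1 (Γ.D t) t (Γ.rd t) (Γ.R s) (Γ.dr s)
  obtain ⟨hax, ha⟩ := h4.2 s (Γ.R s) (Γ.dr s).symm (Γ.D t) hid
  simp only [Γ.comp_id_left] at hb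
  simp only [Γ.comp_id_right, ← Γ.tc1 (Γ.R s) (Γ.D t) (Γ.dr s) hid] at hax ha
  have hR : Γ.R (Γ.ra s (Γ.D t)) = Γ.R (Γ.la (Γ.R s) (Γ.D t)) := by
    rw [← ha, Γ.r_comp]
  have hcomp : Γ.R (Γ.ra s (Γ.D t)) =
      Γ.D (Γ.la (Γ.R (Γ.la (Γ.R s) (Γ.D t))) t) := hR.trans hxb
  refine ⟨(smu1 s t).symm, ?_⟩
  have ho : Γ.otimes s t = Γ.comp _ _ hcomp := by
    rw [BiactionCat.otimes, hR, Γ.pcomp_of_eq hcomp]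
  rw [ho]
  have key := Γ.comp_comp_comp_of_idem hax hxx hxb idem
    (by rw [ha, hb]; exact (smu1 s t).symm) (by rw [ha]; exact hcomp)
  simpa only [ha, hb] using key
end
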